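/- The space T = { (F, v, w) : F a smooth homogeneous cubic form over ℂ, v, w ∈ ℂ⁴ linearly independent, and F(s·v + t·w) = 0 for all s, t ∈ ℂ }, regarded as a subspace of ℂ²⁰ × ℂ⁴ × ℂ⁴ (identifying a cubic form with its 20 coefficients), is path-connected. (Equivalently, the incidence variety of pairs (smooth cubic surface, line contained in it) is a connected 27-sheeted cover of the space of smooth cubic surfaces.) -/

import Mathlib

open MvPolynomial

/-- The topology on polynomials induced by their coefficients (on the 20-dimensional
space of homogeneous cubic forms this is the standard topology of `ℂ²⁰`). -/
noncomputable instance : TopologicalSpace (MvPolynomial (Fin 4) ℂ) :=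
  TopologicalSpace.induced (fun F => fun d : Fin 4 →₀ ℕ => coeff d F) inferInstance

open scoped Matrix

theorem Module.End.finite_not_isUnit_one_add_smul {K V : Type*} [Field K] [AddCommGroup V]
    [Module K V] [FiniteDimensional K V] (f : Module.End K V) :
    {z : K | ¬ IsUnit (1 + z • f)}.Finite := by
  refine (f.finite_hasEigenvalue.preimage (f := fun z : K => -z⁻¹)
    ((neg_injective.comp inv_injective).injOn)).subset fun z hz => ?_
  have hz0 : z ≠ 0 := by
    rintro rfl
    simp at hz
  simp only [Set.mem_preimage, Set.mem_ofPred_eq, Module.End.hasEigenvalue_iff_mem_spectrum,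
    spectrum.mem_iff]
  intro h
  apply hz
  have h2 : (1 + z • f) = algebraMap K (Module.End K V) (-z) *
      (algebraMap K (Module.End K V) (-z⁻¹) - f) := by
    rw [mul_sub, ← map_mul, neg_mul_neg, mul_inv_cancel₀ hz0, map_one, map_neg, neg_mul,
      sub_neg_eq_add, Algebra.smul_def]
  rw [h2]
  exact ((neg_ne_zero.mpr hz0).isUnit.map _).mul h

theorem Matrix.finite_not_isUnit_one_add_smul {K n : Type*} [Field K] [Fintype n] [DecidableEq n]
    (N : Matrix n n K) : {z : K | ¬ IsUnit (1 + z • N)}.Finite := by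
  refine (Module.End.finite_not_isUnit_one_add_smul (Matrix.toLin' N)).subset fun z hz h => hz ?_
  rw [← Matrix.isUnit_toLin'_iff, map_add, map_smul, Matrix.toLin'_one]
  exact h

theorem Set.Finite.isPathConnected_compl_complex {s : Set ℂ} (hs : s.Finite) :
    IsPathConnected sᶜ :=
  hs.countable.isPathConnected_compl_of_one_lt_rank (by simp [Complex.rank_real_complex])

namespace MvPolynomial

/-- The partial derivatives of `F` have no common zero other than the origin. -/
def IsSmoothForm {σ R : Type*} [CommSemiring R] (F : MvPolynomial σ R) : Prop :=
  ∀ v : σ → R, v ≠ 0 → ∃ i, eval v (pderiv i F) ≠ 0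

/-- The ideal generated by the partial derivatives. -/
noncomputable def jacobianIdeal {σ R : Type*} [CommSemiring R] (F : MvPolynomial σ R) :
    Ideal (MvPolynomial σ R) :=
  Ideal.span (Set.range fun i => pderiv i F)

section Line

variable {σ K : Type*} [Field K]

theorem homogeneousComponent_mem_jacobianIdeal {F : MvPolynomial σ K} {d : ℕ}
    (hF : F.IsHomogeneous d) {p : MvPolynomial σ K} (hp : p ∈ jacobianIdeal F) (n : ℕ) :
    homogeneousComponent n p ∈ jacobianIdeal F := by
  let _ := MvPolynomial.gradedAlgebra (σ := σ) (R := K)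
  refine homogeneousComponent_mem_of_mem (Ideal.homogeneous_span _ _ ?_) hp n
  rintro _ ⟨i, rfl⟩
  exact ⟨d - 1, hF.pderiv⟩

theorem eval_eq_zero_of_mem_jacobianIdeal {F : MvPolynomial σ K} {v : σ → K}
    (hv : ∀ i, eval v (pderiv i F) = 0) {p : MvPolynomial σ K} (hp : p ∈ jacobianIdeal F) :
    eval v p = 0 := by
  have h : jacobianIdeal F ≤ RingHom.ker (eval v) := by
    rw [jacobianIdeal, Ideal.span_le]
    rintro _ ⟨i, rfl⟩
    exact hv i
  exact h hp

variable [Finite σ]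

theorem IsSmoothForm.exists_pow_idealOfVars_le [IsAlgClosed K] {F : MvPolynomial σ K}
    (hF : F.IsSmoothForm) : ∃ n, idealOfVars σ K ^ n ≤ jacobianIdeal F := by
  refine Ideal.exists_pow_le_of_le_radical_of_fg ?_ (idealOfVars_fg σ K)
  rw [← vanishingIdeal_zeroLocus_eq_radical (K := K), idealOfVars, Ideal.span_le]
  rintro _ ⟨i, rfl⟩ v hv
  have hv0 : v = 0 := by
    by_contra h
    obtain ⟨j, hj⟩ := hF v h
    exact hj (by simpa using hv _ (Ideal.subset_span ⟨j, rfl⟩))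
  simp [hv0]

theorem IsSmoothForm.finite_not_isSmoothForm_add_smul [IsAlgClosed K] {F H : MvPolynomial σ K}
    {d : ℕ} (hFd : F.IsHomogeneous d) (hHd : H.IsHomogeneous d) (hF : F.IsSmoothForm) :
    {z : K | ¬ (F + z • H).IsSmoothForm}.Finite := by
  have := Fintype.ofFinite σ
  obtain ⟨n, hn⟩ := hF.exists_pow_idealOfVars_le
  let W := homogeneousSubmodule σ K n
  have : FiniteDimensional K W := Module.Finite.iff_fg.mpr (homogeneousSubmodule_fg σ K n)
  have hW : ∀ p : W, ∃ q : W, ∀ z : K, ((p + z • q : W) : MvPolynomial σ K) ∈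
      jacobianIdeal (F + z • H) := by
    intro p
    have hp : (p : MvPolynomial σ K) ∈ jacobianIdeal F :=
      hn ((mem_pow_idealOfVars_iff _ _).mpr fun x hx => by
        have := p.2 (mem_support_iff.mp hx)
        exact ((DFunLike.congr_fun (Finsupp.degree_eq_weight_one) x).trans this).ge)
    obtain ⟨c, hc⟩ := (Ideal.mem_span_range_iff_exists_fun).mp hp
    refine ⟨⟨homogeneousComponent n (∑ i, c i * pderiv i H), homogeneousComponent_mem _ _⟩,
      fun z => ?_⟩
    have h1 : ∑ i, c i * pderiv i (F + z • H) ∈ jacobianIdeal (F + z • H) :=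
      Ideal.sum_mem _ fun i _ => Ideal.mul_mem_left _ _ (Ideal.subset_span ⟨i, rfl⟩)
    have hd : (F + z • H).IsHomogeneous d :=
      hFd.add ((homogeneousSubmodule σ K d).smul_mem z hHd)
    have h2 := homogeneousComponent_mem_jacobianIdeal hd h1 n
    convert h2 using 1
    have h3 : ∑ i, c i * pderiv i (F + z • H) =
        (p : MvPolynomial σ K) + z • ∑ i, c i * pderiv i H := by
      rw [← hc, Finset.smul_sum, ← Finset.sum_add_distrib]
      exact Finset.sum_congr rfl fun i _ => by
        rw [map_add, Derivation.map_smul, mul_add, mul_smul_comm]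
    rw [h3, map_add, map_smul, homogeneousComponent_eq_self p.2]
    rfl
  choose q hq using hW
  let b := Module.finBasis K W
  let A : Module.End K W := b.constr K fun i => q (b i)
  have hA : ∀ (z : K) (p : W), (((1 + z • A) p : W) : MvPolynomial σ K) ∈
      jacobianIdeal (F + z • H) := by
    intro z
    have h : (⊤ : Submodule K W) ≤ ((jacobianIdeal (F + z • H)).restrictScalars K).comap
        (W.subtype ∘ₗ (1 + z • A)) := by
      rw [← b.span_eq, Submodule.span_le]
      rintro _ ⟨i, rfl⟩
      have h1 : (1 + z • A) (b i) = b i + z • q (b i) := by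
        simp [A]
      simpa [h1] using hq (b i) z
    exact fun p => h (Submodule.mem_top (x := p))
  refine (Module.End.finite_not_isUnit_one_add_smul A).subset fun z hz hu => hz ?_
  intro v hv
  by_contra! h
  apply hv
  funext i
  obtain ⟨p, hp⟩ := ((Module.End.isUnit_iff _).mp hu).surjective ⟨X i ^ n, by
    have := (isHomogeneous_X K i).pow n
    rwa [one_mul] at this⟩
  have := eval_eq_zero_of_mem_jacobianIdeal h (hA z p)
  rw [hp] at this
  simp only [map_pow, eval_X] at this
  exact eq_zero_of_pow_eq_zero this

end Line
end MvPolynomial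

namespace MvPolynomial

theorem continuous_of_coeff {X : Type*} [TopologicalSpace X]
    {f : X → MvPolynomial (Fin 4) ℂ} (h : ∀ d, Continuous fun x => coeff d (f x)) :
    Continuous f :=
  continuous_induced_rng.mpr (continuous_pi h)

theorem continuous_coeff (d : Fin 4 →₀ ℕ) :
    Continuous fun F : MvPolynomial (Fin 4) ℂ => coeff d F :=
  (continuous_apply d).comp continuous_induced_dom

instance : ContinuousAdd (MvPolynomial (Fin 4) ℂ) where
  continuous_add := continuous_of_coeff fun d => by
    simp only [coeff_add]
    exact ((continuous_coeff d).comp continuous_fst).add ((continuous_coeff d).comp continuous_snd)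

instance : ContinuousMul (MvPolynomial (Fin 4) ℂ) where
  continuous_mul := continuous_of_coeff fun d => by
    simp only [coeff_mul]
    exact continuous_finsetSum _ fun x _ => ((continuous_coeff x.1).comp continuous_fst).mul
      ((continuous_coeff x.2).comp continuous_snd)

theorem continuous_C_coeff : Continuous (C : ℂ → MvPolynomial (Fin 4) ℂ) :=
  continuous_of_coeff fun d => by
    simp only [coeff_C]
    split_ifs <;> fun_prop

/-- The composition of the polynomial `F` with the linear map given by the matrix `M`. -/
noncomputable def linearSubst {n R : Type*} [Fintype n] [CommRing R] (M : Matrix n n R) :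
    MvPolynomial n R →ₐ[R] MvPolynomial n R :=
  aeval fun i => ∑ j, C (M i j) * X j

section

variable {n R : Type*} [Fintype n] [CommRing R]

theorem eval_linearSubst (M : Matrix n n R) (F : MvPolynomial n R) (v : n → R) :
    eval v (linearSubst M F) = eval (M *ᵥ v) F := by
  induction F using MvPolynomial.induction_on with
  | C a => simp [linearSubst]
  | add p q hp hq => simp [hp, hq]
  | mul_X p i hp =>
    rw [map_mul, map_mul, hp]
    simp [linearSubst, Matrix.mulVec, dotProduct]

theorem pderiv_linearSubst (M : Matrix n n R) (F : MvPolynomial n R) (j : n) :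
    pderiv j (linearSubst M F) = ∑ i, linearSubst M (pderiv i F) * C (M i j) := by
  classical
  induction F using MvPolynomial.induction_on with
  | C a => simp [linearSubst]
  | add p q hp hq => simp [hp, hq, add_mul, Finset.sum_add_distrib]
  | mul_X p i hp =>
    have h : pderiv j (linearSubst M (X i)) = C (M i j) := by
      simp [linearSubst, pderiv_X, Pi.single_apply]
    simp only [map_mul, Derivation.leibniz, hp, h, map_add, smul_eq_mul, pderiv_X, Pi.single_apply,
      add_mul, Finset.sum_add_distrib, Finset.mul_sum]
    simp [mul_assoc]

theorem IsHomogeneous.linearSubst {F : MvPolynomial n R} {d : ℕ} (hF : F.IsHomogeneous d)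
    (M : Matrix n n R) : (linearSubst M F).IsHomogeneous d := by
  have := hF.aeval (fun i => ∑ j, C (M i j) * X j) (n := 1) fun i =>
    IsHomogeneous.sum _ _ _ fun j _ => isHomogeneous_C_mul_X _ _
  rwa [one_mul] at this

theorem linearSubst_one [DecidableEq n] (F : MvPolynomial n R) :
    MvPolynomial.linearSubst (1 : Matrix n n R) F = F := by
  simp [MvPolynomial.linearSubst, Matrix.one_apply]

theorem IsSmoothForm.linearSubst {K : Type*} [Field K] [DecidableEq n] {F : MvPolynomial n K}
    (hF : F.IsSmoothForm) {M : Matrix n n K} (hM : IsUnit M) :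
    (MvPolynomial.linearSubst M F).IsSmoothForm := by
  intro v hv
  have hv' : M *ᵥ v ≠ 0 := fun h =>
    hv (Matrix.mulVec_injective_iff_isUnit.mpr hM (h.trans (M.mulVec_zero).symm))
  obtain ⟨i, hi⟩ := hF (M *ᵥ v) hv'
  by_contra! h
  apply hi
  have h2 : (fun i => eval (M *ᵥ v) (pderiv i F)) ᵥ* M = 0 ᵥ* M := by
    funext j
    have := h j
    simp only [pderiv_linearSubst, map_sum, map_mul, eval_linearSubst, eval_C] at this
    rw [Matrix.zero_vecMul]
    exact this
  exact congrFun (Matrix.vecMul_injective_iff_isUnit.mpr hM h2) i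

end

theorem continuous_linearSubst (F : MvPolynomial (Fin 4) ℂ) :
    Continuous fun M : Matrix (Fin 4) (Fin 4) ℂ => linearSubst M F := by
  induction F using MvPolynomial.induction_on with
  | C a => simpa [linearSubst] using continuous_const
  | add p q hp hq => simp only [map_add]; exact hp.add hq
  | mul_X p i hp =>
    simp only [map_mul]
    refine hp.mul ?_
    simp only [linearSubst, aeval_X]
    exact continuous_finsetSum _ fun j _ =>
      (continuous_C_coeff.comp (Continuous.matrix_elem continuous_id i j)).mul continuous_const

theorem continuous_add_smul (F H : MvPolynomial (Fin 4) ℂ) : Continuous fun z : ℂ => F + z • H := by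
  simp only [smul_eq_C_mul]
  exact continuous_const.add (continuous_C_coeff.mul continuous_const)

end MvPolynomial

theorem Module.Basis.sumExtend_inl {K V ι : Type*} [DivisionRing K] [AddCommGroup V] [Module K V]
    {v : ι → V} (hv : LinearIndependent K v) (i : ι) :
    Module.Basis.sumExtend hv (Sum.inl i) = v i := by
  simp only [Module.Basis.sumExtend, Module.Basis.coe_reindex, Function.comp_apply,
    Module.Basis.extend_apply_self]
  rfl

theorem LinearIndependent.exists_isUnit_mulVec_eq {K n ι : Type*} [Field K] [Fintype n]
    [DecidableEq n] {v w : ι → n → K} (hv : LinearIndependent K v) (hw : LinearIndependent K w) :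
    ∃ g : Matrix n n K, IsUnit g ∧ ∀ i, g *ᵥ v i = w i := by
  have := hv.finite
  let b := Module.Basis.sumExtend hv
  let c := Module.Basis.sumExtend hw
  have hb := Module.Finite.finite_basis b
  have hc := Module.Finite.finite_basis c
  have := Finite.sum_right ι (β := Module.Basis.sumExtendIndex hv)
  have := Finite.sum_right ι (β := Module.Basis.sumExtendIndex hw)
  have hcard := Nat.card_congr (b.indexEquiv c)
  rw [Nat.card_sum, Nat.card_sum, Nat.add_left_cancel_iff] at hcard
  let e := b.equiv c ((Equiv.refl ι).sumCongr (Classical.choice (Finite.card_eq.mp hcard)))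
  refine ⟨LinearMap.toMatrix' e.toLinearMap, ?_, fun i => ?_⟩
  · rw [← Matrix.isUnit_toLin'_iff, Matrix.toLin'_toMatrix', Module.End.isUnit_iff]
    exact e.bijective
  · have h := b.equiv_apply (b' := c) (Sum.inl i)
      ((Equiv.refl ι).sumCongr (Classical.choice (Finite.card_eq.mp hcard)))
    rw [LinearMap.toMatrix'_mulVec]
    simpa [b, c, e, Module.Basis.sumExtend_inl] using h

namespace MvPolynomial

/-- Triples of a smooth form of degree `d` and two vectors spanning a plane on which it vanishes. -/
def smoothFormPlanes (d : ℕ) : Set (MvPolynomial (Fin 4) ℂ × (Fin 4 → ℂ) × (Fin 4 → ℂ)) :=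
  {t | t.1.IsHomogeneous d ∧ t.1.IsSmoothForm ∧ LinearIndependent ℂ ![t.2.1, t.2.2] ∧
    ∀ s u : ℂ, eval (s • t.2.1 + u • t.2.2) t.1 = 0}

theorem joinedIn_smoothFormPlanes_of_form {d : ℕ} {F G : MvPolynomial (Fin 4) ℂ}
    {v w : Fin 4 → ℂ} (hF : (F, v, w) ∈ smoothFormPlanes d) (hG : (G, v, w) ∈ smoothFormPlanes d) :
    JoinedIn (smoothFormPlanes d) (F, v, w) (G, v, w) := by
  obtain ⟨hF1, hF2, hvw, hF3⟩ := hF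
  obtain ⟨hG1, hG2, -, hG3⟩ := hG
  have hH : (G - F).IsHomogeneous d := hG1.sub hF1
  have hpc := ((hF2.finite_not_isSmoothForm_add_smul hF1 hH).isPathConnected_compl_complex).image
    ((continuous_add_smul F (G - F)).prodMk (continuous_const (y := (v, w))))
  refine (hpc.joinedIn _ ⟨0, by simpa using hF2, by simp⟩ _ ⟨1, by simpa using hG2, by simp⟩).mono ?_
  rintro _ ⟨z, hz, rfl⟩
  refine ⟨hF1.add ((homogeneousSubmodule _ _ d).smul_mem z hH), by simpa using hz, hvw,
    fun s u => ?_⟩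
  have h1 := hF3 s u
  have h2 := hG3 s u
  simp only at h1 h2
  simp [h1, h2, smul_eval]

theorem linearSubst_inv_mem_smoothFormPlanes {d : ℕ} {F : MvPolynomial (Fin 4) ℂ}
    {v w : Fin 4 → ℂ} (hF : (F, v, w) ∈ smoothFormPlanes d) {M : Matrix (Fin 4) (Fin 4) ℂ}
    (hM : IsUnit M) : (linearSubst M⁻¹ F, M *ᵥ v, M *ᵥ w) ∈ smoothFormPlanes d := by
  obtain ⟨hF1, hF2, hvw, hF3⟩ := hF
  refine ⟨hF1.linearSubst _, hF2.linearSubst (Matrix.isUnit_nonsing_inv_iff.mpr hM), ?_,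
    fun s u => ?_⟩
  · have h := hvw.map' M.mulVecLin
      (LinearMap.ker_eq_bot.mpr (Matrix.mulVec_injective_iff_isUnit.mpr hM))
    have h2 : M.mulVecLin ∘ ![v, w] = ![M *ᵥ v, M *ᵥ w] := by
      funext i
      fin_cases i <;> rfl
    exact h2 ▸ h
  · simp only
    rw [eval_linearSubst, ← Matrix.mulVec_smul, ← Matrix.mulVec_smul, ← Matrix.mulVec_add,
      Matrix.mulVec_mulVec, Matrix.nonsing_inv_mul _ ((Matrix.isUnit_iff_isUnit_det M).mp hM),
      Matrix.one_mulVec]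
    exact hF3 s u

theorem joinedIn_smoothFormPlanes_linearSubst {d : ℕ} {F : MvPolynomial (Fin 4) ℂ}
    {v w : Fin 4 → ℂ} (hF : (F, v, w) ∈ smoothFormPlanes d) {M : Matrix (Fin 4) (Fin 4) ℂ}
    (hM : IsUnit M) :
    JoinedIn (smoothFormPlanes d) (F, v, w) (linearSubst M⁻¹ F, M *ᵥ v, M *ᵥ w) := by
  let P : ℂ → Matrix (Fin 4) (Fin 4) ℂ := fun z => 1 + z • (M - 1)
  have hP : Continuous P := by fun_prop
  have hPinv : ContinuousOn (fun z => (P z)⁻¹) {z | ¬ IsUnit (P z)}ᶜ := by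
    simp only [Matrix.inv_def, Ring.inverse_eq_inv']
    refine ContinuousOn.smul (hP.matrix_det.continuousOn.inv₀ fun z hz => ?_)
      hP.matrix_adjugate.continuousOn
    exact ((Matrix.isUnit_iff_isUnit_det _).mp (by simpa using hz)).ne_zero
  have hpc := ((Matrix.finite_not_isUnit_one_add_smul (M - 1)).isPathConnected_compl_complex).image'
    (((continuous_linearSubst F).comp_continuousOn hPinv).prodMk
      ((hP.matrix_mulVec (continuous_const (y := v))).prodMk
        (hP.matrix_mulVec (continuous_const (y := w)))).continuousOn)
  refine (hpc.joinedIn _ ⟨0, by simp, by simp [P, linearSubst_one]⟩ _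
    ⟨1, by simpa using hM, by simp [P]⟩).mono ?_
  rintro _ ⟨z, hz, rfl⟩
  exact linearSubst_inv_mem_smoothFormPlanes hF (by simpa using hz)

theorem joinedIn_smoothFormPlanes {d : ℕ} {x y : MvPolynomial (Fin 4) ℂ × (Fin 4 → ℂ) × (Fin 4 → ℂ)}
    (hx : x ∈ smoothFormPlanes d) (hy : y ∈ smoothFormPlanes d) :
    JoinedIn (smoothFormPlanes d) x y := by
  obtain ⟨F, v, w⟩ := x
  obtain ⟨G, v', w'⟩ := y
  obtain ⟨M, hM, hMv⟩ := hx.2.2.1.exists_isUnit_mulVec_eq hy.2.2.1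
  have h0 : M *ᵥ v = v' := hMv 0
  have h1 : M *ᵥ w = w' := hMv 1
  have h := joinedIn_smoothFormPlanes_linearSubst hx hM
  rw [h0, h1] at h
  exact h.trans (joinedIn_smoothFormPlanes_of_form h.target_mem hy)

theorem fermat_mem_smoothFormPlanes :
    (∑ i, X i ^ 3, ![1, -1, 0, 0], ![0, 0, 1, -1]) ∈ smoothFormPlanes 3 := by
  refine ⟨IsHomogeneous.sum _ _ _ fun i _ => ?_, fun v hv => ?_, ?_, fun s u => ?_⟩
  · have := (isHomogeneous_X ℂ i).pow 3
    rwa [one_mul] at this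
  · obtain ⟨i, hi⟩ := Function.ne_iff.mp hv
    refine ⟨i, ?_⟩
    simpa [Derivation.leibniz_pow, pderiv_X, Pi.single_apply] using hi
  · rw [LinearIndependent.pair_iff]
    intro s t h
    have h0 := congrFun h 0
    have h2 := congrFun h 2
    simpa using And.intro h0 h2
  · simp [Fin.sum_univ_four]
    ring

end MvPolynomial

/-- The incidence variety of triples `(F, v, w)` where `F` is a smooth homogeneous cubic
form over `ℂ` and `v, w` span a 2-dimensional subspace of `ℂ⁴` on which `F` vanishes
identically, is path-connected (equivalently, the space of pairs (smooth cubic surface,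
line on it) is a connected 27-sheeted cover of the space of smooth cubic surfaces). -/
theorem incidence_variety_path_connected :
    IsPathConnected {t : MvPolynomial (Fin 4) ℂ × (Fin 4 → ℂ) × (Fin 4 → ℂ) |
      t.1.IsHomogeneous 3 ∧
      (∀ v : Fin 4 → ℂ, v ≠ 0 → ∃ i : Fin 4, eval v (pderiv i t.1) ≠ 0) ∧
      LinearIndependent ℂ ![t.2.1, t.2.2] ∧
      ∀ s u : ℂ, eval (s • t.2.1 + u • t.2.2) t.1 = 0} :=
  ⟨_, MvPolynomial.fermat_mem_smoothFormPlanes,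
    fun {_} hy => MvPolynomial.joinedIn_smoothFormPlanes MvPolynomial.fermat_mem_smoothFormPlanes hy⟩
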